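/- arXiv:1311.1803 — 3 statements merged into one kernel-verified Lean document; each statement's English description precedes it below -/
import Mathlib

section
/- For every m ≥ 3 there exist a load balancing game with m servers, a Nash equilibrium assignment σ, and a coalitional deviation σ′ from σ in which every coalition job j satisfies L_σ(σ(j)) ≥ (5/4)·L_{σ′}(σ′(j)). In particular, for m = 3 one may take six jobs of lengths 2, 3, 2, 3, 5, 5, the NE assignment σ placing jobs of lengths {2,3} on server 1, {2,3} on server 2 and {5,5} on server 3, and the coalitional deviation σ′ in which both length-2 jobs migrate to server 3 and the two length-5 jobs migrate one to server 1 and one to server 2, so every coalition member's cost decreases by a factor of exactly 5/4 (from 5 to 4, respectively from 10 to 8). -/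
/-- The workload of server `i` under assignment `σ`. -/
def load {n m : ℕ} (p : Fin n → ℝ) (σ : Fin n → Fin m) (i : Fin m) : ℝ :=
  ∑ j ∈ Finset.univ.filter (fun j => σ j = i), p j

/-- `σ` is a Nash equilibrium assignment. -/
def IsNE {n m : ℕ} (p : Fin n → ℝ) (σ : Fin n → Fin m) : Prop :=
  ∀ j i, load p σ (σ j) ≤ load p σ i + p j

/-- `σ'` is a coalitional deviation from `σ`. -/
def IsDeviation {n m : ℕ} (p : Fin n → ℝ) (σ σ' : Fin n → Fin m) : Prop :=
  (∃ j, σ' j ≠ σ j) ∧ ∀ j, σ' j ≠ σ j → load p σ' (σ' j) < load p σ (σ j)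

/-- The assignment running `σ` and `τ` side by side on disjoint groups of servers. -/
def juxtapose {a b k l : ℕ} (σ : Fin a → Fin k) (τ : Fin b → Fin l) : Fin (a + b) → Fin (k + l) :=
  Fin.append (fun j => Fin.castAdd l (σ j)) (fun j => Fin.natAdd k (τ j))

theorem juxtapose_castAdd {a b k l : ℕ} (σ : Fin a → Fin k) (τ : Fin b → Fin l) (j : Fin a) :
    juxtapose σ τ (Fin.castAdd b j) = Fin.castAdd l (σ j) :=
  Fin.append_left _ _ j

theorem juxtapose_natAdd {a b k l : ℕ} (σ : Fin a → Fin k) (τ : Fin b → Fin l) (j : Fin b) :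
    juxtapose σ τ (Fin.natAdd a j) = Fin.natAdd k (τ j) :=
  Fin.append_right _ _ j

theorem load_juxtapose_castAdd {a b k l : ℕ} (p : Fin a → ℝ) (q : Fin b → ℝ)
    (σ : Fin a → Fin k) (τ : Fin b → Fin l) (i : Fin k) :
    load (Fin.append p q) (juxtapose σ τ) (Fin.castAdd l i) = load p σ i := by
  have h (j : Fin b) : Fin.natAdd k (τ j) ≠ Fin.castAdd l i := by
    simp only [ne_eq, Fin.ext_iff, Fin.val_natAdd, Fin.val_castAdd]
    omega
  rw [load, load, Finset.sum_filter, Finset.sum_filter, Fin.sum_univ_add]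
  simp [juxtapose, h]

theorem load_juxtapose_natAdd {a b k l : ℕ} (p : Fin a → ℝ) (q : Fin b → ℝ)
    (σ : Fin a → Fin k) (τ : Fin b → Fin l) (i : Fin l) :
    load (Fin.append p q) (juxtapose σ τ) (Fin.natAdd k i) = load q τ i := by
  have h (j : Fin a) : Fin.castAdd l (σ j) ≠ Fin.natAdd k i := by
    simp only [ne_eq, Fin.ext_iff, Fin.val_natAdd, Fin.val_castAdd]
    omega
  rw [load, load, Finset.sum_filter, Finset.sum_filter, Fin.sum_univ_add]
  simp [juxtapose, h]

theorem load_id {n : ℕ} (p : Fin n → ℝ) (i : Fin n) : load p id i = p i := by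
  simp [load, Finset.sum_filter]

/-- Job lengths of the three-server instance. -/
def baseLength : Fin 6 → ℕ := ![2, 3, 2, 3, 5, 5]

/-- The equilibrium of the three-server instance. -/
def baseNE : Fin 6 → Fin 3 := ![0, 0, 1, 1, 2, 2]

/-- The assignment reached by the deviating coalition in the three-server instance. -/
def baseDeviation : Fin 6 → Fin 3 := ![2, 0, 2, 1, 0, 1]

theorem load_natCast {n m : ℕ} (w : Fin n → ℕ) (σ : Fin n → Fin m) (i : Fin m) :
    load (fun j => (w j : ℝ)) σ i = ((∑ j with σ j = i, w j : ℕ) : ℝ) := by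
  simp [load]

theorem baseLength_pos (j : Fin 6) : (0 : ℝ) < baseLength j := by
  have h : ∀ j, 0 < baseLength j := by decide
  exact_mod_cast h j

theorem load_baseNE_le (i : Fin 3) : load (fun j => (baseLength j : ℝ)) baseNE i ≤ 10 := by
  have h : ∀ i, ∑ j with baseNE j = i, baseLength j ≤ 10 := by decide
  rw [load_natCast]
  exact_mod_cast h i

theorem isNE_base : IsNE (fun j => (baseLength j : ℝ)) baseNE := by
  have h : ∀ j i, ∑ j' with baseNE j' = baseNE j, baseLength j' ≤
      ∑ j' with baseNE j' = i, baseLength j' + baseLength j := by decide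
  intro j i
  rw [load_natCast, load_natCast]
  beta_reduce
  exact_mod_cast h j i

theorem five_fourth_mul_load_base_le (j : Fin 6) (hj : baseDeviation j ≠ baseNE j) :
    5 / 4 * load (fun j => (baseLength j : ℝ)) baseDeviation (baseDeviation j) ≤
      load (fun j => (baseLength j : ℝ)) baseNE (baseNE j) := by
  have h : ∀ j, baseDeviation j ≠ baseNE j →
      5 * ∑ j' with baseDeviation j' = baseDeviation j, baseLength j' ≤
        4 * ∑ j' with baseNE j' = baseNE j, baseLength j' := by decide
  have h' := (Nat.cast_le (α := ℝ)).2 (h j hj)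
  rw [Nat.cast_mul, Nat.cast_mul, ← load_natCast, ← load_natCast] at h'
  push_cast at h'
  linarith

theorem load_nonneg {n m : ℕ} {p : Fin n → ℝ} (hp : ∀ j, 0 < p j) (σ : Fin n → Fin m)
    (i : Fin m) : 0 ≤ load p σ i :=
  Finset.sum_nonneg fun j _ => (hp j).le

theorem le_load {n m : ℕ} {p : Fin n → ℝ} (hp : ∀ j, 0 < p j) (σ : Fin n → Fin m)
    (j : Fin n) : p j ≤ load p σ (σ j) :=
  Finset.single_le_sum (fun j _ => (hp j).le) (by simp)

/-- For every `m ≥ 3` there is a load balancing game with `m` servers, an NE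
assignment `σ` and a coalitional deviation `σ'` from `σ` in which every
coalition job `j` satisfies `L_σ(σ j) ≥ (5/4) · L_{σ'}(σ' j)`. -/
theorem exists_ne_with_five_fourth_deviation (m : ℕ) (hm : 3 ≤ m) :
    ∃ (n : ℕ) (p : Fin n → ℝ) (σ σ' : Fin n → Fin m),
      (∀ j, 0 < p j) ∧ IsNE p σ ∧ IsDeviation p σ σ' ∧
      ∀ j, σ' j ≠ σ j → (5 / 4) * load p σ' (σ' j) ≤ load p σ (σ j) := by
  obtain ⟨k, rfl⟩ := Nat.exists_eq_add_of_le hm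
  have hp : ∀ j, 0 < Fin.append (fun j => (baseLength j : ℝ)) (fun _ : Fin k => (10 : ℝ)) j := by
    intro j
    refine Fin.addCases (fun j => ?_) (fun j => ?_) j
    · simpa using baseLength_pos j
    · simp
  have hratio : ∀ j, juxtapose baseDeviation (id : Fin k → Fin k) j ≠ juxtapose baseNE id j →
      5 / 4 * load (Fin.append (fun j => (baseLength j : ℝ)) fun _ => 10) (juxtapose baseDeviation id)
        (juxtapose baseDeviation (id : Fin k → Fin k) j) ≤
      load (Fin.append (fun j => (baseLength j : ℝ)) fun _ => 10) (juxtapose baseNE id)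
        (juxtapose baseNE (id : Fin k → Fin k) j) := by
    intro j
    refine Fin.addCases (fun j hj => ?_) (fun j hj => ?_) j
    · rw [juxtapose_castAdd, juxtapose_castAdd] at hj ⊢
      rw [load_juxtapose_castAdd, load_juxtapose_castAdd]
      exact five_fourth_mul_load_base_le j fun h => hj (by rw [h])
    · exact absurd (by rw [juxtapose_natAdd, juxtapose_natAdd]) hj
  refine ⟨6 + k, Fin.append (fun j => (baseLength j : ℝ)) fun _ => 10, juxtapose baseNE id,
    juxtapose baseDeviation id, hp, ?_, ⟨⟨Fin.castAdd k 0, ?_⟩, fun j hj => ?_⟩, hratio⟩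
  · intro j i
    refine Fin.addCases (fun j => ?_) (fun j => ?_) j
    · rw [juxtapose_castAdd, load_juxtapose_castAdd, Fin.append_left]
      refine Fin.addCases (fun i => ?_) (fun i => ?_) i
      · rw [load_juxtapose_castAdd]
        exact isNE_base j i
      · rw [load_juxtapose_natAdd, load_id]
        linarith [baseLength_pos j, load_baseNE_le (baseNE j)]
    · rw [juxtapose_natAdd, load_juxtapose_natAdd, Fin.append_right, load_id]
      linarith [load_nonneg hp (juxtapose baseNE id) i]
  · rw [juxtapose_castAdd, juxtapose_castAdd]
    simp [baseNE, baseDeviation, Fin.ext_iff]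
  · linarith [hratio j hj, hp j, le_load hp (juxtapose baseDeviation id) j]
end

section
/- Let σ′ be a coalitional deviation from an NE assignment σ of an m-server load balancing game in which all m servers participate, and let A be the arc set of its deviation graph. Then there is no permutation π of the m servers with π(i) ≠ i and (i, π(i)) ∈ A for every server i; equivalently, the deviation graph contains no set of node-disjoint directed cycles covering every node. -/
/-- Server `i` participates in the deviation: its job set changes. -/
def Participates {n m : ℕ} (σ σ' : Fin n → Fin m) (i : Fin m) : Prop :=
  {j | σ j = i} ≠ {j | σ' j = i}

/-- `(u,v)` is an arc of the deviation graph: some coalition job migrates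
from `u` to `v`. -/
def Arc {n m : ℕ} (σ σ' : Fin n → Fin m) (u v : Fin m) : Prop :=
  ∃ j, σ' j ≠ σ j ∧ σ j = u ∧ σ' j = v

/-- The total workload does not depend on the assignment. -/
theorem sum_load {n m : ℕ} (p : Fin n → ℝ) (σ : Fin n → Fin m) :
    ∑ i, load p σ i = ∑ j, p j :=
  Finset.sum_fiberwise Finset.univ σ p

/-- If all `m` servers are involved in a coalitional deviation from an NE, then
there is no permutation `π` of the servers with `π i ≠ i` and `(i, π i)` an arc
of the deviation graph for every `i`; i.e., the deviation graph has no family of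
node-disjoint directed cycles covering every node. -/
theorem no_spanning_disjoint_cycles {n m : ℕ}
    (p : Fin n → ℝ) (hp : ∀ j, 0 < p j)
    (σ : Fin n → Fin m) (hNE : IsNE p σ)
    (σ' : Fin n → Fin m) (hdev : IsDeviation p σ σ')
    (hall : ∀ i, Participates σ σ' i) :
    ¬ ∃ π : Equiv.Perm (Fin m), ∀ i, π i ≠ i ∧ Arc σ σ' i (π i) := by
  rintro ⟨π, hπ⟩
  obtain ⟨⟨j, -⟩, himp⟩ := hdev
  have hlt : ∀ i, load p σ' (π i) < load p σ i := by
    intro i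
    obtain ⟨-, k, hk, hu, hv⟩ := hπ i
    simpa only [hu, hv] using himp k hk
  have hsum : ∑ i, load p σ' (π i) < ∑ i, load p σ i :=
    Finset.sum_lt_sum_of_nonempty ⟨σ j, Finset.mem_univ _⟩ fun i _ => hlt i
  rw [Equiv.sum_comp π (load p σ'), sum_load, sum_load] at hsum
  exact lt_irrefl _ hsum
end

section
/- Let σ′ be a minimal coalitional deviation from an NE assignment σ of a load balancing game. Then the deviation graph of σ′ is strongly connected: for any two participating servers u and v there is a directed path from u to v using arcs of A. -/
/-- The improvement ratio of a coalitional deviation. -/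
noncomputable def IR {n m : ℕ} (p : Fin n → ℝ) (σ σ' : Fin n → Fin m) : ℝ :=
  sInf {r | ∃ j, σ' j ≠ σ j ∧ r = load p σ (σ j) / load p σ' (σ' j)}

/-- A coalitional deviation is minimal if every coalitional deviation with a
strictly smaller coalition has a strictly smaller improvement ratio. -/
def IsMinimalDeviation {n m : ℕ} (p : Fin n → ℝ) (σ σ' : Fin n → Fin m) : Prop :=
  IsDeviation p σ σ' ∧
    ∀ σ'' : Fin n → Fin m, IsDeviation p σ σ'' →
      {j | σ'' j ≠ σ j} ⊂ {j | σ' j ≠ σ j} → IR p σ σ'' < IR p σ σ'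

theorem load_pos {n m : ℕ} {p : Fin n → ℝ} (hp : ∀ j, 0 < p j)
    (σ : Fin n → Fin m) (j : Fin n) : 0 < load p σ (σ j) :=
  Finset.sum_pos (fun k _ => hp k) ⟨j, by simp⟩

theorem load_le_load {n m : ℕ} {p : Fin n → ℝ} (hp : ∀ j, 0 < p j)
    {σ τ : Fin n → Fin m} {i : Fin m} (h : ∀ j, σ j = i → τ j = i) :
    load p σ i ≤ load p τ i :=
  Finset.sum_le_sum_of_subset_of_nonneg
    (fun j hj => by simpa using h j (by simpa using hj)) fun j _ _ => (hp j).le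

theorem load_add_le_load {n m : ℕ} {p : Fin n → ℝ} (hp : ∀ j, 0 < p j)
    {σ τ : Fin n → Fin m} {i : Fin m} (h : ∀ j, σ j = i → τ j = i)
    {k : Fin n} (hk : σ k ≠ i) (hk' : τ k = i) :
    load p σ i + p k ≤ load p τ i := by
  have hmem : k ∉ Finset.univ.filter (fun j => σ j = i) := by simpa using hk
  rw [load, add_comm, ← Finset.sum_insert hmem]
  refine Finset.sum_le_sum_of_subset_of_nonneg (fun j hj => ?_) fun j _ _ => (hp j).le
  rcases Finset.mem_insert.1 hj with rfl | hj
  · simpa using hk'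
  · simpa using h j (by simpa using hj)

/-- In a coalitional deviation from a Nash equilibrium, some job leaves each participating
server: a server that only gains jobs is at least as bad as before for any newcomer. -/
theorem IsDeviation.exists_leaving {n m : ℕ} {p : Fin n → ℝ} (hp : ∀ j, 0 < p j)
    {σ σ' : Fin n → Fin m} (hNE : IsNE p σ) (hdev : IsDeviation p σ σ')
    {i : Fin m} (hi : Participates σ σ' i) : ∃ j, σ' j ≠ σ j ∧ σ j = i := by
  by_contra! hstay
  have hsub : ∀ j, σ j = i → σ' j = i := fun j hj => by
    by_contra hne
    exact hstay j (fun h => hne (h.trans hj)) hj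
  apply hi
  ext k
  refine ⟨hsub k, fun hk => ?_⟩
  by_contra hne
  change σ' k = i at hk
  change ¬ σ k = i at hne
  have hlt := hdev.2 k (fun h => hne (h.symm.trans hk))
  rw [hk] at hlt
  linarith [hNE k i, load_add_le_load hp hsub hne hk]

/-- Restricting a deviation to a smaller coalition without increasing the loads of the
destinations gives a deviation with at least the same improvement ratio. -/
theorem IsDeviation.of_load_le {n m : ℕ} {p : Fin n → ℝ} (hp : ∀ j, 0 < p j)
    {σ σ' τ : Fin n → Fin m} (hdev : IsDeviation p σ σ') (hne : ∃ j, τ j ≠ σ j)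
    (hτ : ∀ j, τ j ≠ σ j → τ j = σ' j ∧ load p τ (τ j) ≤ load p σ' (τ j)) :
    IsDeviation p σ τ ∧ IR p σ σ' ≤ IR p σ τ := by
  refine ⟨⟨hne, fun j hj => ?_⟩, ?_⟩
  · obtain ⟨heq, hle⟩ := hτ j hj
    rw [heq] at hj hle ⊢
    exact hle.trans_lt (hdev.2 j hj)
  · obtain ⟨j₀, hj₀⟩ := hne
    refine le_csInf ⟨_, j₀, hj₀, rfl⟩ ?_
    rintro r ⟨j, hj, rfl⟩
    obtain ⟨heq, hle⟩ := hτ j hj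
    have hbdd : BddBelow {r | ∃ j, σ' j ≠ σ j ∧ r = load p σ (σ j) / load p σ' (σ' j)} := by
      refine ⟨0, ?_⟩
      rintro r ⟨k, -, rfl⟩
      exact div_nonneg (load_nonneg hp _ _) (load_nonneg hp _ _)
    refine (csInf_le hbdd ⟨j, heq ▸ hj, rfl⟩).trans ?_
    rw [← heq]
    exact div_le_div_of_nonneg_left (load_nonneg hp _ _) (load_pos hp τ j) hle

theorem exists_path_of_reflTransGen {α : Type*} {r : α → α → Prop} {a b : α}
    (h : Relation.ReflTransGen r a b) :
    ∃ (k : ℕ) (f : ℕ → α), f 0 = a ∧ f k = b ∧ ∀ t < k, r (f t) (f (t + 1)) := by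
  induction h using Relation.ReflTransGen.head_induction_on with
  | refl => exact ⟨0, fun _ => b, rfl, rfl, by simp⟩
  | @head a c hac _ ih =>
    obtain ⟨k, f, hf0, hfk, hf⟩ := ih
    refine ⟨k + 1, fun t => Nat.casesOn t a f, rfl, hfk, ?_⟩
    rintro (_ | t) ht
    · simpa [hf0] using hac
    · exact hf t (by omega)

/-- A minimal deviation graph is strongly connected: between any two
participating servers there is a directed path of arcs. -/
theorem minimal_deviation_strongly_connected {n m : ℕ}
    (p : Fin n → ℝ) (hp : ∀ j, 0 < p j)
    (σ : Fin n → Fin m) (hNE : IsNE p σ)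
    (σ' : Fin n → Fin m) (hmin : IsMinimalDeviation p σ σ')
    (u v : Fin m) (hu : Participates σ σ' u) (hv : Participates σ σ' v) :
    ∃ (k : ℕ) (f : ℕ → Fin m), f 0 = u ∧ f k = v ∧
      ∀ t < k, Arc σ σ' (f t) (f (t + 1)) := by
  classical
  obtain ⟨hdev, hmin⟩ := hmin
  apply exists_path_of_reflTransGen
  by_contra huv
  let S : Set (Fin m) := {w | Relation.ReflTransGen (Arc σ σ') u w}
  have hS : ∀ j, σ' j ≠ σ j → σ j ∈ S → σ' j ∈ S := fun j hj hjS =>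
    Relation.ReflTransGen.tail hjS ⟨j, hj, rfl, rfl⟩
  obtain ⟨a, ha, hau⟩ := hdev.exists_leaving hp hNE hu
  obtain ⟨b, hb, hbv⟩ := hdev.exists_leaving hp hNE hv
  have haS : σ a ∈ S := hau ▸ Relation.ReflTransGen.refl
  have hbS : σ b ∉ S := hbv ▸ huv
  let τ : Fin n → Fin m := fun j => if σ j ∈ S then σ' j else σ j
  have hτ_in : ∀ j, σ j ∈ S → τ j = σ' j := fun j hj => if_pos hj
  have hτ_out : ∀ j, σ j ∉ S → τ j = σ j := fun j hj => if_neg hj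
  have hτ_mem : ∀ j, τ j ≠ σ j → σ j ∈ S := fun j hj => by
    by_contra h
    exact hj (hτ_out j h)
  have hτ : ∀ j, τ j ≠ σ j → τ j = σ' j ∧ load p τ (τ j) ≤ load p σ' (τ j) := by
    intro j hj
    have hjS := hτ_mem j hj
    have heq := hτ_in j hjS
    refine ⟨heq, load_le_load hp fun k hk => ?_⟩
    by_cases hkS : σ k ∈ S
    · rw [← hτ_in k hkS, hk]
    · refine absurd ?_ hkS
      rw [← hτ_out k hkS, hk, heq]
      exact hS j (heq ▸ hj) hjS
  obtain ⟨hτdev, hIR⟩ := hdev.of_load_le hp ⟨a, by rwa [hτ_in a haS]⟩ hτ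
  refine (hmin τ hτdev ⟨fun j hj => ?_, fun hsub => ?_⟩).not_ge hIR
  · change σ' j ≠ σ j
    rw [← (hτ j hj).1]
    exact hj
  · exact hsub hb (hτ_out b hbS)
end
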